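/- The map C ↦ F(C) is a bijection from the set of group-theoretical categories of partitions onto the set of sS_∞-invariant normal subgroups of Z_2^{*∞}, with inverse H ↦ C_H; moreover, for group-theoretical categories C and D one has C ⊆ D if and only if F(C) ⊆ F(D), so F is an isomorphism of lattices. -/

import Mathlib

open Classical

/-- A partition diagram with `upper` upper points and `lower` lower points; the blocks are
encoded by the equivalence relation (setoid) on the disjoint union of the points. -/
structure PartitionDiagram where
  upper : ℕ
  lower : ℕ
  rel : Setoid (Fin upper ⊕ Fin lower)

namespace PartitionDiagram

/-- The partition determined by a labelling of the points: two points lie in the same block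
iff they receive the same label. -/
def ofLabels {u l : ℕ} (f : Fin u ⊕ Fin l → ℕ) : PartitionDiagram :=
  ⟨u, l, Setoid.ker f⟩

/-- The identity partition `| ∈ P(1,1)`. -/
def idPartition : PartitionDiagram := ofLabels (u := 1) (l := 1) fun _ => 0

/-- The pair partition `⊓ ∈ P(0,2)`. -/
def pairPartition : PartitionDiagram := ofLabels (u := 0) (l := 2) fun _ => 0

/-- The four block partition `⊓⊓ ∈ P(0,4)`. -/
def fourBlock : PartitionDiagram := ofLabels (u := 0) (l := 4) fun _ => 0

/-- The singleton partition `↑ ∈ P(0,1)`. -/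
def singletonPartition : PartitionDiagram := ofLabels (u := 0) (l := 1) fun _ => 0

/-- The double singleton partition `↑⊗↑ ∈ P(0,2)`. -/
def doubleSingleton : PartitionDiagram :=
  ofLabels (u := 0) (l := 2) (Sum.elim (fun i => (i : ℕ)) fun j => (j : ℕ))

/-- The crossing partition `⨯ ∈ P(2,2)`, with blocks `{1,2'}` and `{2,1'}`. -/
def crossing : PartitionDiagram :=
  ofLabels (u := 2) (l := 2) (Sum.elim (fun i => (i : ℕ)) fun j => 1 - (j : ℕ))

/-- The pair positioner partition `▷ ∈ P(3,3)`, with blocks `{1,2,2',3'}` and `{3,1'}`. -/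
def pairPositioner : PartitionDiagram :=
  ofLabels (u := 3) (l := 3)
    (Sum.elim (fun i => if (i : ℕ) = 2 then 1 else 0) fun j => if (j : ℕ) = 0 then 1 else 0)

/-- The partition `k_l ∈ P(l+2, l+2)` consisting of the four block `{1, 1', l+2, (l+2)'}`
together with the pairs `{j, j'}` for `2 ≤ j ≤ l+1`. -/
def kPart (n : ℕ) : PartitionDiagram :=
  ofLabels (u := n + 2) (l := n + 2)
    (fun x => if (Sum.elim Fin.val Fin.val x) = 0 ∨ (Sum.elim Fin.val Fin.val x) = n + 1
      then 0 else Sum.elim Fin.val Fin.val x)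

/-- The involution `p* ∈ P(l,k)` of `p ∈ P(k,l)`: turn the partition upside down. -/
def invol (p : PartitionDiagram) : PartitionDiagram :=
  ⟨p.lower, p.upper, Setoid.comap Sum.swap p.rel⟩

/-- Auxiliary map splitting the points of a tensor product into the points of the two factors. -/
def splitPoint {a b c d : ℕ} (x : Fin (a + b) ⊕ Fin (c + d)) :
    (Fin a ⊕ Fin c) ⊕ (Fin b ⊕ Fin d) :=
  match x with
  | Sum.inl u =>
    match finSumFinEquiv.symm u with
    | Sum.inl i => Sum.inl (Sum.inl i)
    | Sum.inr i => Sum.inr (Sum.inl i)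
  | Sum.inr v =>
    match finSumFinEquiv.symm v with
    | Sum.inl j => Sum.inl (Sum.inr j)
    | Sum.inr j => Sum.inr (Sum.inr j)

/-- The tensor product (horizontal concatenation) `p ⊗ q` of two partitions. -/
def tensor (p q : PartitionDiagram) : PartitionDiagram :=
  ⟨p.upper + q.upper, p.lower + q.lower,
    Setoid.ker fun x =>
      Sum.map (Quotient.mk p.rel) (Quotient.mk q.rel) (splitPoint x)⟩

section Composition

variable (p q : PartitionDiagram) (h : p.lower = q.upper)

/-- Inclusion of the points of `p` into the three-row diagram used for composition. -/
def iotaP : Fin p.upper ⊕ Fin p.lower → Fin p.upper ⊕ (Fin p.lower ⊕ Fin q.lower) :=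
  Sum.map id Sum.inl

/-- Inclusion of the points of `q` into the three-row diagram used for composition,
identifying the upper points of `q` with the lower points of `p`. -/
def iotaQ : Fin q.upper ⊕ Fin q.lower → Fin p.upper ⊕ (Fin p.lower ⊕ Fin q.lower) :=
  fun x => Sum.inr (Sum.map (Fin.cast h.symm) id x)

/-- The generating relation on the three-row diagram used for composition. -/
def compRel : Fin p.upper ⊕ (Fin p.lower ⊕ Fin q.lower) →
    Fin p.upper ⊕ (Fin p.lower ⊕ Fin q.lower) → Prop :=
  fun x y =>
    (∃ a b, p.rel.r a b ∧ x = iotaP p q a ∧ y = iotaP p q b) ∨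
    (∃ a b, q.rel.r a b ∧ x = iotaQ p q h a ∧ y = iotaQ p q h b)

/-- The composition (vertical concatenation) `qp ∈ P(k,m)` of `p ∈ P(k,l)` and `q ∈ P(l,m)`:
identify the lower points of `p` with the upper points of `q`, take the join of the block
structures and restrict to the upper points of `p` and the lower points of `q`. -/
def comp : PartitionDiagram :=
  ⟨p.upper, q.lower,
    Setoid.comap (Sum.map id Sum.inr) (Relation.EqvGen.setoid (compRel p q h))⟩

end Composition

/-- Rotation of the leftmost upper point to the leftmost lower position. -/
def rotLU (p : PartitionDiagram) (h : 0 < p.upper) : PartitionDiagram :=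
  ⟨p.upper - 1, p.lower + 1,
    Setoid.comap (fun x => match x with
      | Sum.inl j => Sum.inl (⟨(j : ℕ) + 1, by have := j.isLt; omega⟩ : Fin p.upper)
      | Sum.inr j => if hj : (j : ℕ) = 0 then Sum.inl (⟨0, h⟩ : Fin p.upper)
          else Sum.inr (⟨(j : ℕ) - 1, by have := j.isLt; omega⟩ : Fin p.lower)) p.rel⟩

/-- Rotation of the leftmost lower point to the leftmost upper position. -/
def rotLD (p : PartitionDiagram) (h : 0 < p.lower) : PartitionDiagram :=
  ⟨p.upper + 1, p.lower - 1,
    Setoid.comap (fun x => match x with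
      | Sum.inl j => if hj : (j : ℕ) = 0 then Sum.inr (⟨0, h⟩ : Fin p.lower)
          else Sum.inl (⟨(j : ℕ) - 1, by have := j.isLt; omega⟩ : Fin p.upper)
      | Sum.inr j => Sum.inr (⟨(j : ℕ) + 1, by have := j.isLt; omega⟩ : Fin p.lower)) p.rel⟩

/-- Rotation of the rightmost upper point to the rightmost lower position. -/
def rotRU (p : PartitionDiagram) (h : 0 < p.upper) : PartitionDiagram :=
  ⟨p.upper - 1, p.lower + 1,
    Setoid.comap (fun x => match x with
      | Sum.inl j => Sum.inl (⟨(j : ℕ), by have := j.isLt; omega⟩ : Fin p.upper)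
      | Sum.inr j => if hj : (j : ℕ) < p.lower then Sum.inr (⟨(j : ℕ), hj⟩ : Fin p.lower)
          else Sum.inl (⟨p.upper - 1, by omega⟩ : Fin p.upper)) p.rel⟩

/-- Rotation of the rightmost lower point to the rightmost upper position. -/
def rotRD (p : PartitionDiagram) (h : 0 < p.lower) : PartitionDiagram :=
  ⟨p.upper + 1, p.lower - 1,
    Setoid.comap (fun x => match x with
      | Sum.inl j => if hj : (j : ℕ) < p.upper then Sum.inl (⟨(j : ℕ), hj⟩ : Fin p.upper)
          else Sum.inr (⟨p.lower - 1, by omega⟩ : Fin p.lower)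
      | Sum.inr j => Sum.inr (⟨(j : ℕ), by have := j.isLt; omega⟩ : Fin p.lower)) p.rel⟩

/-- The partition obtained from `p` by merging the block of the point `a` and the block of
the point `b` into a single block, leaving all other blocks unchanged. -/
noncomputable def mergeBlocks (p : PartitionDiagram)
    (a b : Fin p.upper ⊕ Fin p.lower) : PartitionDiagram :=
  ⟨p.upper, p.lower,
    Setoid.ker fun x =>
      if p.rel.r x a ∨ p.rel.r x b then (none : Option (Quotient p.rel))
      else some (Quotient.mk p.rel x)⟩

end PartitionDiagram

open PartitionDiagram

/-- A set of partitions is a category of partitions if it contains the identity partition and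
the pair partition and is closed under tensor products, composition, involution and the four
rotation operations. -/
structure IsPartitionCategory (M : Set PartitionDiagram) : Prop where
  id_mem : idPartition ∈ M
  pair_mem : pairPartition ∈ M
  tensor_mem : ∀ p ∈ M, ∀ q ∈ M, tensor p q ∈ M
  comp_mem : ∀ p ∈ M, ∀ q ∈ M, ∀ h : p.lower = q.upper, comp p q h ∈ M
  invol_mem : ∀ p ∈ M, invol p ∈ M
  rotLU_mem : ∀ p ∈ M, ∀ h : 0 < p.upper, rotLU p h ∈ M
  rotLD_mem : ∀ p ∈ M, ∀ h : 0 < p.lower, rotLD p h ∈ M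
  rotRU_mem : ∀ p ∈ M, ∀ h : 0 < p.upper, rotRU p h ∈ M
  rotRD_mem : ∀ p ∈ M, ∀ h : 0 < p.lower, rotRD p h ∈ M

/-- A category of partitions is group-theoretical if it contains the pair positioner
partition `▷`. -/
def IsGroupTheoreticalCategory (M : Set PartitionDiagram) : Prop :=
  IsPartitionCategory M ∧ pairPositioner ∈ M

/-- The smallest category of partitions containing a given set of partitions. -/
def generatedCategory (S : Set PartitionDiagram) : Set PartitionDiagram :=
  ⋂₀ { M | IsPartitionCategory M ∧ S ⊆ M }

/-- The group `Z_2^{*∞}`: the free product of countably many copies of the cyclic group of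
order two. -/
abbrev FreeZ2 := Monoid.CoprodI (fun _ : ℕ => Multiplicative (ZMod 2))

/-- The free generators `a_1, a_2, …` of `Z_2^{*∞}`, each of order two. -/
def gen (n : ℕ) : FreeZ2 :=
  Monoid.CoprodI.of (i := n) (Multiplicative.ofAdd (1 : ZMod 2))

/-- A labelling of a partition assigns (indices of) pairwise distinct generators of
`Z_2^{*∞}` to the blocks: two points receive the same label iff they lie in the same block. -/
def IsLabelling (p : PartitionDiagram) (lab : Fin p.upper ⊕ Fin p.lower → ℕ) : Prop :=
  ∀ x y, lab x = lab y ↔ p.rel.r x y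

/-- The word `w(p,l) ∈ Z_2^{*∞}` of a labelled partition: after rotating all upper points to
the right-hand end of the lower row, read off the generators assigned to the points from left
to right, i.e. read the lower points from left to right and then the upper points from right
to left. -/
def wordOf (p : PartitionDiagram) (lab : Fin p.upper ⊕ Fin p.lower → ℕ) : FreeZ2 :=
  ((List.ofFn fun j : Fin p.lower => gen (lab (Sum.inr j))) ++
    (List.ofFn fun i : Fin p.upper => gen (lab (Sum.inl i))).reverse).prod

/-- `F(C) ⊆ Z_2^{*∞}` is the set of all `w(p,l)` where `p ∈ C` and `l` is a labelling. -/
def Fmap (M : Set PartitionDiagram) : Set FreeZ2 :=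
  { g | ∃ p ∈ M, ∃ lab, IsLabelling p lab ∧ wordOf p lab = g }

/-- The set of partitions admitting a labelling whose word lies in `H`. -/
def catOf (H : Set FreeZ2) : Set PartitionDiagram :=
  { p | ∃ lab, IsLabelling p lab ∧ wordOf p lab ∈ H }

/-- The endomorphism of `Z_2^{*∞}` identifying letters according to `f`, i.e. sending
`a_k` to `a_{f k}` for every `k`. -/
def identifyLetters (f : ℕ → ℕ) : Monoid.End FreeZ2 :=
  Monoid.CoprodI.lift fun i =>
    (Monoid.CoprodI.of (M := fun _ : ℕ => Multiplicative (ZMod 2)) (i := f i))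

/-- The strong symmetric semigroup `sS_∞`: the subsemigroup of `End(Z_2^{*∞})` generated by
the finite identifications of letters. -/
def strongSymmetricSemigroup : Subsemigroup (Monoid.End FreeZ2) :=
  Subsemigroup.closure
    { φ | ∃ f : ℕ → ℕ, (∃ n : ℕ, ∀ k, n ≤ k → f k = k) ∧ φ = identifyLetters f }

/-- A subset of `Z_2^{*∞}` is `sS_∞`-invariant if it is preserved by every element of the
strong symmetric semigroup. -/
def IsSSInvariant (H : Set FreeZ2) : Prop :=
  ∀ φ ∈ strongSymmetricSemigroup, ∀ g ∈ H, φ g ∈ H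

/-- A partition is in single leg form if it has no upper points and no two consecutive
points belong to the same block. -/
def IsSingleLeg (p : PartitionDiagram) : Prop :=
  p.upper = 0 ∧
    ∀ i j : Fin p.lower, (j : ℕ) = (i : ℕ) + 1 → ¬ p.rel.r (Sum.inr i) (Sum.inr j)

/-- `C_sl`: the set of all partitions in `C` with no upper points in single leg form. -/
def slSet (M : Set PartitionDiagram) : Set PartitionDiagram :=
  { p ∈ M | IsSingleLeg p }

/-- The partition with no upper points determined by a word (a list of letters): two points
lie in the same block iff the corresponding letters coincide. -/
def wordPartition (w : List ℕ) : PartitionDiagram :=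
  ofLabels (u := 0) (l := w.length) (Sum.elim (fun i => (i : ℕ)) fun j => w.get j)

/-- The canonical letter of the block of a lower point: the least index of a point in its
block. -/
noncomputable def blockLabel (p : PartitionDiagram) (j : Fin p.lower) : ℕ :=
  sInf { i : ℕ | ∃ h : i < p.lower, p.rel.r (Sum.inr ⟨i, h⟩) (Sum.inr j) }

/-- The canonical word of a partition with no upper points. -/
noncomputable def canonWord (p : PartitionDiagram) : List ℕ :=
  List.ofFn fun j : Fin p.lower => blockLabel p j

/-- Full reduction of a word over an alphabet of involutions: repeatedly delete adjacent
equal pairs of letters.  This computes the result of iterating the operation replacing every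
exponent in the run-decomposition of the word by its parity. -/
def reduceWord (w : List ℕ) : List ℕ :=
  w.foldr (fun x acc => match acc with
    | [] => [x]
    | y :: rest => if x = y then rest else x :: y :: rest) []

/-- The single leg version of a partition with no upper points: the unique partition in
single leg form obtained by iteratively replacing every exponent in its run-decomposition by
its parity. -/
noncomputable def singleLegVersion (p : PartitionDiagram) : PartitionDiagram :=
  wordPartition (reduceWord (canonWord p))

namespace PartitionDiagram

/-- Some labelling of `p` reads `u` along the upper points and `l` along the lower points. -/
def HasRows (p : PartitionDiagram) (u l : List ℕ) : Prop :=
  ∃ lab, IsLabelling p lab ∧ (List.ofFn fun i => lab (Sum.inl i)) = u ∧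
    (List.ofFn fun j => lab (Sum.inr j)) = l

theorem exists_isLabelling (p : PartitionDiagram) : ∃ lab, IsLabelling p lab := by
  obtain ⟨f, hf⟩ := Countable.exists_injective_nat (Quotient p.rel)
  refine ⟨fun x => f (Quotient.mk p.rel x), fun x y => ?_⟩
  rw [hf.eq_iff, Quotient.eq]

theorem exists_hasRows (p : PartitionDiagram) : ∃ u l, HasRows p u l :=
  let ⟨lab, h⟩ := p.exists_isLabelling
  ⟨_, _, lab, h, rfl, rfl⟩

theorem hasRows_ofLabels {m n : ℕ} (f : Fin m ⊕ Fin n → ℕ) :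
    HasRows (ofLabels f) (List.ofFn fun i => f (Sum.inl i)) (List.ofFn fun j => f (Sum.inr j)) :=
  ⟨f, fun _ _ => Iff.rfl, rfl, rfl⟩

theorem exists_diagram (u l : List ℕ) : ∃ p, HasRows p u l :=
  ⟨ofLabels (Sum.elim u.get l.get), Sum.elim u.get l.get, fun _ _ => Iff.rfl,
    List.ofFn_get u, List.ofFn_get l⟩

namespace HasRows

variable {p q : PartitionDiagram} {u l u' l' : List ℕ} {a : ℕ}

theorem unique (hp : HasRows p u l) (hq : HasRows q u l) : p = q := by
  obtain ⟨lab, h, rfl, rfl⟩ := hp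
  obtain ⟨lab', h', e₁, e₂⟩ := hq
  obtain ⟨m, n, r⟩ := p
  obtain ⟨m', n', r'⟩ := q
  obtain rfl : m' = m := by simpa using congrArg List.length e₁
  obtain rfl : n' = n := by simpa using congrArg List.length e₂
  have e : lab' = lab := by
    funext x
    rcases x with i | j
    · exact congrFun (List.ofFn_injective e₁) i
    · exact congrFun (List.ofFn_injective e₂) j
  subst e
  congr 1
  ext x y
  exact (h x y).symm.trans (h' x y)

theorem map (hp : HasRows p u l) (f : ℕ → ℕ) (hf : Set.InjOn f {a | a ∈ u ++ l}) :
    HasRows p (u.map f) (l.map f) := by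
  obtain ⟨lab, h, rfl, rfl⟩ := hp
  have hm : ∀ x, lab x ∈ {a | a ∈ (List.ofFn fun i => lab (Sum.inl i)) ++
      List.ofFn fun j => lab (Sum.inr j)} := by
    rintro (i | j) <;> simp
  refine ⟨f ∘ lab, fun x y => ?_, ?_, ?_⟩
  · rw [← h, Function.comp, Function.comp, hf.eq_iff (hm x) (hm y)]
  · simp [List.map_ofFn, Function.comp_def]
  · simp [List.map_ofFn, Function.comp_def]

/-- A labelling constant on blocks factors through any labelling. -/
theorem exists_map (hp : HasRows p u l) (lab : Fin p.upper ⊕ Fin p.lower → ℕ)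
    (hlab : ∀ x y, p.rel.r x y → lab x = lab y) :
    ∃ f : ℕ → ℕ, (List.ofFn fun i => lab (Sum.inl i)) = u.map f ∧
      (List.ofFn fun j => lab (Sum.inr j)) = l.map f := by
  obtain ⟨lab', h, rfl, rfl⟩ := hp
  have hf : Function.FactorsThrough lab lab' := fun x y hxy => hlab x y ((h x y).1 hxy)
  have hx : ∀ x, Function.extend lab' lab id (lab' x) = lab x := fun x => hf.extend_apply _ x
  exact ⟨Function.extend lab' lab id, by simp [List.map_ofFn, Function.comp_def, hx],
    by simp [List.map_ofFn, Function.comp_def, hx]⟩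

theorem invol (hp : HasRows p u l) : HasRows p.invol l u := by
  obtain ⟨lab, h, rfl, rfl⟩ := hp
  exact ⟨lab ∘ Sum.swap, fun x y => h _ _, rfl, rfl⟩

theorem tensor (hp : HasRows p u l) (hq : HasRows q u' l')
    (hd : ∀ a ∈ u ++ l, a ∉ u' ++ l') : HasRows (tensor p q) (u ++ u') (l ++ l') := by
  obtain ⟨lab, h, rfl, rfl⟩ := hp
  obtain ⟨lab', h', rfl, rfl⟩ := hq
  have hne : ∀ x y, lab x ≠ lab' y := by
    intro x y e
    refine hd (lab x) ?_ ?_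
    · rcases x with x | x <;> simp
    · rw [e]
      rcases y with y | y <;> simp
  refine ⟨fun x => Sum.elim lab lab' (splitPoint x), fun x y => ?_, ?_, ?_⟩
  · change _ ↔ Sum.map _ _ (splitPoint x) = Sum.map _ _ (splitPoint y)
    beta_reduce
    generalize splitPoint x = x
    generalize splitPoint y = y
    rcases x with x | x <;> rcases y with y | y
    · simpa [Quotient.eq] using h x y
    · simpa using hne x y
    · simpa using (hne y x).symm
    · simpa [Quotient.eq] using h' x y
  · change List.ofFn (n := p.upper + q.upper) _ = _
    rw [← List.ofFn_fin_append]
    congr 1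
    funext x
    refine Fin.addCases (fun i => ?_) (fun i => ?_) x <;> simp [splitPoint]
  · change List.ofFn (n := p.lower + q.lower) _ = _
    rw [← List.ofFn_fin_append]
    congr 1
    funext x
    refine Fin.addCases (fun i => ?_) (fun i => ?_) x <;> simp [splitPoint]

theorem upper_length (hp : HasRows p u l) : p.upper = u.length := by
  obtain ⟨lab, h, rfl, rfl⟩ := hp
  simp

theorem lower_length (hp : HasRows p u l) : p.lower = l.length := by
  obtain ⟨lab, h, rfl, rfl⟩ := hp
  simp

theorem rotLU (hp : HasRows p u l) (h₀ : 0 < p.upper) (hu : u = a :: u') :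
    HasRows (rotLU p h₀) u' (a :: l) := by
  obtain ⟨lab, h, rfl, rfl⟩ := hp
  obtain ⟨_ | m, n, r⟩ := p
  · exact absurd h₀ (lt_irrefl 0)
  simp only [List.ofFn_succ, List.cons.injEq] at hu
  obtain ⟨rfl, rfl⟩ := hu
  refine ⟨_, fun x y => h _ _, rfl, List.ofFn_succ (n := n)⟩

theorem rotLD (hp : HasRows p u l) (h₀ : 0 < p.lower) (hl : l = a :: l') :
    HasRows (rotLD p h₀) (a :: u) l' := by
  obtain ⟨lab, h, rfl, rfl⟩ := hp
  obtain ⟨m, _ | n, r⟩ := p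
  · exact absurd h₀ (lt_irrefl 0)
  simp only [List.ofFn_succ, List.cons.injEq] at hl
  obtain ⟨rfl, rfl⟩ := hl
  refine ⟨_, fun x y => h _ _, List.ofFn_succ (n := m), rfl⟩

theorem rotRU (hp : HasRows p u l) (h₀ : 0 < p.upper) (hu : u = u' ++ [a]) :
    HasRows (rotRU p h₀) u' (l ++ [a]) := by
  obtain ⟨lab, h, rfl, rfl⟩ := hp
  obtain ⟨_ | m, n, r⟩ := p
  · exact absurd h₀ (lt_irrefl 0)
  simp only [List.ofFn_succ', List.concat_eq_append, List.append_singleton_inj] at hu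
  obtain ⟨rfl, rfl⟩ := hu
  refine ⟨_, fun x y => h _ _, rfl, ?_⟩
  refine (List.ofFn_succ' (n := n) _).trans ((List.concat_eq_append ..).trans ?_)
  exact congrArg₂ (fun s t => s ++ [t])
    (congrArg List.ofFn (funext fun i => congrArg lab (dif_pos i.isLt)))
    (congrArg lab (dif_neg (lt_irrefl n)))

theorem rotRD (hp : HasRows p u l) (h₀ : 0 < p.lower) (hl : l = l' ++ [a]) :
    HasRows (rotRD p h₀) (u ++ [a]) l' := by
  obtain ⟨lab, h, rfl, rfl⟩ := hp
  obtain ⟨m, _ | n, r⟩ := p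
  · exact absurd h₀ (lt_irrefl 0)
  simp only [List.ofFn_succ', List.concat_eq_append, List.append_singleton_inj] at hl
  obtain ⟨rfl, rfl⟩ := hl
  refine ⟨_, fun x y => h _ _, ?_, rfl⟩
  refine (List.ofFn_succ' (n := m) _).trans ((List.concat_eq_append ..).trans ?_)
  exact congrArg₂ (fun s t => s ++ [t])
    (congrArg List.ofFn (funext fun i => congrArg lab (dif_pos i.isLt)))
    (congrArg lab (dif_neg (lt_irrefl m)))

/-- Capping off the two lower points of `p` with a pair merges their blocks. -/
theorem comp_cap {x y : ℕ} (hp : HasRows p u [x, y]) (hq : HasRows q [0, 0] [])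
    (h : p.lower = q.upper) :
    HasRows (comp p q h) (u.map fun a => if a = y then x else a) [] := by
  have hq₂ := hq.upper_length
  have hq₀ := hq.lower_length
  obtain ⟨lab, hlab, rfl, hxy⟩ := hp
  obtain ⟨labq, hlabq, hq0, -⟩ := hq
  obtain ⟨m, n, r⟩ := p
  obtain ⟨m', n', r'⟩ := q
  have hnm := h
  obtain rfl : n = m' := hnm
  obtain rfl : n = 2 := hq₂
  obtain rfl : n' = 0 := hq₀
  have hr' : ∀ i j : Fin 2, r' (Sum.inl i) (Sum.inl j) := by
    simp only [List.ofFn_succ, List.ofFn_zero, List.cons.injEq] at hq0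
    have h0 : ∀ i : Fin 2, labq (Sum.inl i) = 0 := by
      intro i
      fin_cases i
      exacts [hq0.1, hq0.2.1]
    exact fun i j => (hlabq _ _).1 ((h0 i).trans (h0 j).symm)
  simp only [List.ofFn_succ, List.ofFn_zero, List.cons.injEq] at hxy
  obtain ⟨rfl, rfl, -⟩ := hxy
  set x := lab (Sum.inr 0)
  set y := lab (Sum.inr (Fin.succ 0))
  set g : ℕ → ℕ := fun a => if a = y then x else a with hg
  have hgi : ∀ i : Fin 2, g (lab (Sum.inr i)) = x := by
    intro i
    fin_cases i <;> simp [hg, x, y]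
  refine ⟨Sum.elim (fun i => g (lab (Sum.inl i))) (fun j => Fin.elim0 j), ?_,
    (List.map_ofFn (f := fun i : Fin m => lab (Sum.inl i)) (g := g)).symm, rfl⟩
  have key : ∀ i j : Fin m, g (lab (Sum.inl i)) = g (lab (Sum.inl j)) ↔
      Relation.EqvGen (compRel ⟨m, 2, r⟩ ⟨2, 0, r'⟩ h) (Sum.inl i) (Sum.inl j) := by
    intro i j
    have hpp : ∀ a b, lab a = lab b → Relation.EqvGen (compRel ⟨m, 2, r⟩ ⟨2, 0, r'⟩ h)
        (iotaP ⟨m, 2, r⟩ ⟨2, 0, r'⟩ a) (iotaP ⟨m, 2, r⟩ ⟨2, 0, r'⟩ b) := fun a b e =>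
      .rel _ _ (Or.inl ⟨a, b, (hlab a b).1 e, rfl, rfl⟩)
    have hqq : ∀ a b : Fin 2, Relation.EqvGen (compRel ⟨m, 2, r⟩ ⟨2, 0, r'⟩ h)
        (Sum.inr (Sum.inl a)) (Sum.inr (Sum.inl b)) := fun a b =>
      .rel _ _ (Or.inr ⟨Sum.inl a, Sum.inl b, hr' a b, rfl, rfl⟩)
    constructor
    · intro e
      have e' : lab (Sum.inl i) = lab (Sum.inl j) ∨
          ∃ a b : Fin 2, lab (Sum.inl i) = lab (Sum.inr a) ∧
            lab (Sum.inr b) = lab (Sum.inl j) := by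
        simp only [hg] at e
        split_ifs at e with h₁ h₂ h₂
        · exact Or.inl (h₁.trans h₂.symm)
        · exact Or.inr ⟨1, 0, h₁, e⟩
        · exact Or.inr ⟨0, 1, e, h₂.symm⟩
        · exact Or.inl e
      rcases e' with e' | ⟨a, b, e₁, e₂⟩
      · exact hpp (Sum.inl i) (Sum.inl j) e'
      · exact .trans _ _ _ (hpp (Sum.inl i) (Sum.inr a) e₁)
          (.trans _ _ _ (hqq a b) (hpp (Sum.inr b) (Sum.inl j) e₂))
    · let c : Fin m ⊕ (Fin 2 ⊕ Fin 0) → ℕ :=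
        Sum.elim (fun i => g (lab (Sum.inl i)))
          (Sum.elim (fun i => g (lab (Sum.inr i))) fun j => Fin.elim0 j)
      suffices hc : ∀ s t, Relation.EqvGen (compRel ⟨m, 2, r⟩ ⟨2, 0, r'⟩ h) s t → c s = c t from
        hc _ _
      intro s t hst
      induction hst with
      | rel s t hst =>
        rcases hst with ⟨a, b, hab, rfl, rfl⟩ | ⟨a, b, hab, rfl, rfl⟩
        · have hι : ∀ a, c (iotaP ⟨m, 2, r⟩ ⟨2, 0, r'⟩ a) = g (lab a) := by
            rintro (a | a) <;> rfl
          rw [hι, hι, (hlab a b).2 hab]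
        · have hι : ∀ a, c (iotaQ ⟨m, 2, r⟩ ⟨2, 0, r'⟩ h a) = x := by
            rintro (a | a)
            · exact hgi a
            · exact Fin.elim0 a
          rw [hι, hι]
      | refl => rfl
      | symm _ _ _ ih => exact ih.symm
      | trans _ _ _ _ _ ih₁ ih₂ => exact ih₁.trans ih₂
  rintro (i | i) (j | j)
  · exact key i j
  · exact Fin.elim0 j
  · exact Fin.elim0 i
  · exact Fin.elim0 i

end HasRows

end PartitionDiagram

open PartitionDiagram

/-- The closure properties of the set of words read off the partitions without upper points in
a group-theoretical category. -/
structure IsGroupTheoreticalLanguage (S : Set (List ℕ)) : Prop where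
  pair_mem : [0, 0] ∈ S
  positioner_mem : [1, 0, 0, 1, 0, 0] ∈ S
  rotate_mem : ∀ a w, a :: w ∈ S → w ++ [a] ∈ S
  reverse_mem : ∀ w ∈ S, w.reverse ∈ S
  relabel_mem : ∀ w ∈ S, ∀ f : ℕ → ℕ, Set.InjOn f {a | a ∈ w} → w.map f ∈ S
  append_mem : ∀ v ∈ S, ∀ w ∈ S, (∀ a ∈ v, a ∉ w) → v ++ w ∈ S
  contract_mem : ∀ x y w, x :: y :: w ∈ S → (w.map fun a => if a = y then x else a) ∈ S

theorem List.map_ite_eq_of_notMem {w : List ℕ} {x y : ℕ} (h : y ∉ w) :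
    (w.map fun a => if a = y then x else a) = w := by
  conv_rhs => rw [← List.map_id w]
  refine List.map_congr_left fun a ha => if_neg ?_
  rintro rfl
  exact h ha

namespace IsGroupTheoreticalLanguage

variable {S : Set (List ℕ)} (hS : IsGroupTheoreticalLanguage S)
include hS

theorem append_comm_mem {v w : List ℕ} (h : v ++ w ∈ S) : w ++ v ∈ S := by
  induction v generalizing w with
  | nil => simpa using h
  | cons a v ih =>
    have := hS.rotate_mem a _ h
    simpa using ih (w := w ++ [a]) (by simpa using this)

theorem merge_fresh_mem {x y : ℕ} {w v : List ℕ} (h : x :: y :: (w ++ v) ∈ S) (hv : y ∉ v) :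
    (w.map fun a => if a = y then x else a) ++ v ∈ S := by
  have := hS.contract_mem x y _ h
  rwa [List.map_append, List.map_ite_eq_of_notMem hv] at this

theorem delete_mem {x : ℕ} {w : List ℕ} (h : x :: x :: w ∈ S) : w ∈ S := by
  have := hS.contract_mem x x _ h
  rwa [show (fun a => if a = x then x else a) = id by
    funext a; split_ifs with h <;> simp [h], List.map_id] at this

theorem pair_mem' (c : ℕ) : [c, c] ∈ S :=
  hS.relabel_mem _ hS.pair_mem (fun _ => c) (by intro a ha b hb _; simp_all)

theorem positioner_mem' {c d : ℕ} (h : c ≠ d) : [d, c, c, d, c, c] ∈ S := by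
  refine hS.relabel_mem _ hS.positioner_mem (fun n => if n = 1 then d else c) ?_
  intro a ha b hb e
  simp at ha hb
  have ha' : a = 0 ∨ a = 1 := by tauto
  have hb' : b = 0 ∨ b = 1 := by tauto
  rcases ha' with rfl | rfl <;> rcases hb' with rfl | rfl <;> simp_all

theorem fourBlock_mem (c : ℕ) : [c, c, c, c] ∈ S := by
  have h := hS.rotate_mem _ _ (hS.rotate_mem _ _ (hS.positioner_mem' (Nat.succ_ne_self c).symm))
  simpa using hS.contract_mem _ _ _ h

theorem insert_cons_mem {y : ℕ} {r : List ℕ} (h : y :: r ∈ S) : y :: y :: y :: r ∈ S := by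
  obtain ⟨c, hc⟩ := Infinite.exists_notMem_finset (y :: r).toFinset
  rw [List.mem_toFinset] at hc
  have h₁ := hS.append_comm_mem (v := r) (w := [y, c, c, c, c]) (by
    simpa using hS.append_mem _ (hS.rotate_mem _ _ h) _ (hS.fourBlock_mem c) (by
      intro a ha hac
      apply hc
      obtain rfl : a = c := by simpa using hac
      simpa [or_comm] using ha))
  simpa using hS.merge_fresh_mem (w := [c, c, c]) h₁ (fun h => hc (List.mem_cons_of_mem _ h))

theorem move_cons_mem {y z : ℕ} {r : List ℕ} (h : y :: y :: z :: r ∈ S) :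
    z :: y :: y :: r ∈ S := by
  obtain ⟨c, hc⟩ := Infinite.exists_notMem_finset (y :: z :: r).toFinset
  obtain ⟨d, hd⟩ := Infinite.exists_notMem_finset (c :: y :: z :: r).toFinset
  rw [List.mem_toFinset] at hc hd
  simp only [List.mem_cons, not_or] at hc hd
  obtain ⟨hcy, hcz, hcr⟩ := hc
  obtain ⟨hdc, hdy, hdz, hdr⟩ := hd
  have h₁ : r ++ [y, y, z] ++ [d, c, c, d, c, c] ∈ S := by
    refine hS.append_mem _ (hS.append_comm_mem (v := [y, y, z]) h) _
      (hS.positioner_mem' (Ne.symm hdc)) ?_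
    intro a ha hac
    simp only [List.mem_cons, List.not_mem_nil, or_false, List.mem_append] at ha hac
    have hac' : a = c ∨ a = d := by tauto
    rcases hac' with rfl | rfl <;> simp_all
  have h₂ : z :: d :: ([c, c, d, c, c] ++ (r ++ [y, y])) ∈ S :=
    hS.append_comm_mem (v := r ++ [y, y]) (w := [z, d, c, c, d, c, c]) (by simpa using h₁)
  have h₃ : [c, c, z, c, c] ++ (r ++ [y, y]) ∈ S := by
    simpa [Ne.symm hdc] using hS.merge_fresh_mem h₂ (by simp [hdy, hdr])
  have h₄ : y :: c :: ([c, z, c, c] ++ (r ++ [y])) ∈ S :=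
    hS.append_comm_mem (v := [c, c, z, c, c] ++ (r ++ [y])) (w := [y]) (by simpa using h₃)
  have h₅ : [y, z, y, y] ++ (r ++ [y]) ∈ S := by
    simpa [Ne.symm hcz] using hS.merge_fresh_mem h₄ (by simp [hcy, hcr])
  exact hS.delete_mem (hS.append_comm_mem (v := [y, z, y, y] ++ r) (w := [y]) (by simpa using h₅))

theorem move_append_mem {y : ℕ} {s r : List ℕ} (h : y :: y :: (s ++ r) ∈ S) :
    s ++ y :: y :: r ∈ S := by
  induction s generalizing r with
  | nil => exact h
  | cons z s ih =>
    have h₁ := hS.append_comm_mem (v := [z]) (w := y :: y :: (s ++ r)) (hS.move_cons_mem h)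
    have h₂ := hS.append_comm_mem (v := s ++ y :: y :: r) (w := [z])
      (by simpa using ih (r := r ++ [z]) (by simpa using h₁))
    simpa using h₂

theorem merge_mem_of_cons {x y : ℕ} {v : List ℕ} (h : x :: v ∈ S) (hy : y ∈ v) :
    ((x :: v).map fun a => if a = x then y else a) ∈ S := by
  obtain ⟨s, t, rfl⟩ := List.append_of_mem hy
  have h₁ := hS.insert_cons_mem (y := y) (r := t ++ x :: s)
    (hS.append_comm_mem (v := x :: s) (w := y :: t) h)
  have h₂ := hS.move_append_mem (s := y :: t) (r := x :: s) h₁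
  have h₃ := hS.append_comm_mem (v := y :: t ++ [y]) (w := y :: x :: s) (by simpa using h₂)
  have h₄ := hS.contract_mem y x (s ++ (y :: t ++ [y])) h₃
  have h₅ := hS.append_comm_mem
    (v := (s ++ y :: t).map fun a => if a = x then y else a) (w := [y]) (by
      have hyy : (if y = x then y else y) = y := ite_self y
      simpa [hyy] using h₄)
  simpa using h₅

theorem merge_mem {x y : ℕ} {w : List ℕ} (h : w ∈ S) (hx : x ∈ w) (hy : y ∈ w) (hxy : x ≠ y) :
    (w.map fun a => if a = x then y else a) ∈ S := by
  obtain ⟨s, t, rfl⟩ := List.append_of_mem hx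
  have h₁ := hS.merge_mem_of_cons (x := x) (y := y) (v := t ++ s)
    (hS.append_comm_mem (v := s) (w := x :: t) h) (by
      simp only [List.mem_append, List.mem_cons] at hy ⊢
      tauto)
  have h₂ := hS.append_comm_mem (v := (x :: t).map fun a => if a = x then y else a)
    (w := s.map fun a => if a = x then y else a) (by simpa using h₁)
  simpa using h₂

theorem map_mem {w : List ℕ} (h : w ∈ S) (f : ℕ → ℕ) : w.map f ∈ S := by
  induction hn : w.toFinset.card using Nat.strong_induction_on generalizing w with
  | _ n ih =>
    by_cases hf : Set.InjOn f {a | a ∈ w}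
    · exact hS.relabel_mem w h f hf
    · simp only [Set.InjOn, not_forall] at hf
      obtain ⟨x, hx, y, hy, hfxy, hxy⟩ := hf
      have h₁ := ih _ ?_ (hS.merge_mem h hx hy hxy) rfl
      · rw [List.map_map] at h₁
        rwa [List.map_congr_left (g := f)] at h₁
        intro a _
        simp only [Function.comp_apply]
        split_ifs with ha
        · rw [ha, hfxy]
        · rfl
      · rw [← hn]
        refine Finset.card_lt_card (Finset.ssubset_iff.2 ⟨x, ?_, ?_⟩)
        · simp only [List.mem_toFinset, List.mem_map, not_exists, not_and]
          intro a _
          split_ifs with ha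
          · exact Ne.symm hxy
          · exact ha
        · intro a ha
          simp only [Finset.mem_insert, List.mem_toFinset, List.mem_map] at ha ⊢
          rcases ha with rfl | ⟨b, hb, rfl⟩
          · exact hx
          · split_ifs
            · exact hy
            · exact hb

theorem insert_mem {v w : List ℕ} (h : v ++ w ∈ S) (x : ℕ) : v ++ x :: x :: w ∈ S := by
  obtain ⟨c, hc⟩ := Infinite.exists_notMem_finset (w ++ v).toFinset
  rw [List.mem_toFinset] at hc
  have h₁ : (w ++ v) ++ [c, c] ∈ S :=
    hS.append_mem _ (hS.append_comm_mem h) _ (hS.pair_mem' c) (by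
      intro a ha hac
      obtain rfl : a = c := by simpa using hac
      exact hc ha)
  have h₂ := hS.map_mem h₁ fun a => if a = c then x else a
  rw [List.map_append, List.map_ite_eq_of_notMem hc] at h₂
  exact hS.append_comm_mem (v := x :: x :: w) (w := v)
    (by simpa using hS.append_comm_mem h₂)

theorem insert_mem_iff {v w : List ℕ} (x : ℕ) : v ++ x :: x :: w ∈ S ↔ v ++ w ∈ S := by
  refine ⟨fun h => ?_, fun h => hS.insert_mem h x⟩
  exact hS.append_comm_mem (hS.delete_mem (hS.append_comm_mem h))

theorem append_mem' {v w : List ℕ} (hv : v ∈ S) (hw : w ∈ S) : v ++ w ∈ S := by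
  have h := hS.append_mem _ (hS.map_mem hv fun n => 2 * n) _ (hS.map_mem hw fun n => 2 * n + 1)
    (by
      intro a ha hb
      simp only [List.mem_map] at ha hb
      omega)
  have h' := hS.map_mem h fun n => n / 2
  rw [List.map_append, List.map_map, List.map_map] at h'
  have e₁ : ((fun n => n / 2) ∘ fun n => 2 * n) = id := by
    funext n
    simp
  have e₂ : ((fun n => n / 2) ∘ fun n => 2 * n + 1) = id := by
    funext n
    simp
    omega
  rwa [e₁, e₂, List.map_id, List.map_id] at h'

theorem conj_mem {w : List ℕ} (h : w ∈ S) (v : List ℕ) : v ++ w ++ v.reverse ∈ S := by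
  induction v with
  | nil => simpa using h
  | cons a v ih =>
    have h₁ := hS.insert_mem (w := []) (by simpa using ih) a
    have h₂ := hS.append_comm_mem (v := v ++ w ++ v.reverse ++ [a]) (w := [a]) (by simpa using h₁)
    simpa using h₂

end IsGroupTheoreticalLanguage

/-- The words read off the partitions of `M` without upper points. -/
def lowerWords (M : Set PartitionDiagram) : Set (List ℕ) :=
  { w | ∃ p ∈ M, HasRows p [] w }

namespace IsPartitionCategory

variable {M : Set PartitionDiagram} (hM : IsPartitionCategory M)
include hM

theorem exists_hasRows_iff (u l : List ℕ) :
    (∃ p ∈ M, HasRows p u l) ↔ l ++ u.reverse ∈ lowerWords M := by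
  induction u using List.reverseRecOn generalizing l with
  | nil => simp [lowerWords]
  | append_singleton u a ih =>
    rw [List.reverse_append, List.reverse_singleton, ← List.append_assoc, ← ih]
    constructor
    · rintro ⟨p, hp, h⟩
      have h₀ : 0 < p.upper := by simp [h.upper_length]
      exact ⟨_, hM.rotRU_mem p hp h₀, h.rotRU h₀ rfl⟩
    · rintro ⟨p, hp, h⟩
      have h₀ : 0 < p.lower := by simp [h.lower_length]
      exact ⟨_, hM.rotRD_mem p hp h₀, h.rotRD h₀ rfl⟩

theorem mem_iff_of_hasRows {p : PartitionDiagram} {u l : List ℕ} (h : HasRows p u l) :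
    p ∈ M ↔ l ++ u.reverse ∈ lowerWords M := by
  rw [← hM.exists_hasRows_iff]
  refine ⟨fun hp => ⟨p, hp, h⟩, ?_⟩
  rintro ⟨q, hq, h'⟩
  rwa [h.unique h']

end IsPartitionCategory

theorem IsGroupTheoreticalCategory.isGroupTheoreticalLanguage {M : Set PartitionDiagram}
    (hM : IsGroupTheoreticalCategory M) : IsGroupTheoreticalLanguage (lowerWords M) := by
  obtain ⟨hM, hpos⟩ := hM
  have hpair : [0, 0] ∈ lowerWords M :=
    ⟨_, hM.pair_mem, by
      simpa [pairPartition, List.ofFn_succ] using hasRows_ofLabels (m := 0) (n := 2) fun _ => 0⟩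
  refine ⟨hpair, ?_, ?_, ?_, ?_, ?_, ?_⟩
  · refine (hM.mem_iff_of_hasRows (p := pairPositioner) (u := [0, 0, 1]) (l := [1, 0, 0]) ?_).1 hpos
    simpa [pairPositioner, List.ofFn_succ] using hasRows_ofLabels (m := 3) (n := 3)
      (Sum.elim (fun i => if (i : ℕ) = 2 then 1 else 0) fun j => if (j : ℕ) = 0 then 1 else 0)
  · rintro a w ⟨p, hp, h⟩
    have h₀ : 0 < p.lower := by simp [h.lower_length]
    exact (hM.exists_hasRows_iff [a] w).1 ⟨_, hM.rotLD_mem p hp h₀, h.rotLD h₀ rfl⟩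
  · rintro w ⟨p, hp, h⟩
    simpa using (hM.exists_hasRows_iff w []).1 ⟨_, hM.invol_mem p hp, h.invol⟩
  · rintro w ⟨p, hp, h⟩ f hf
    exact ⟨p, hp, h.map f (by simpa using hf)⟩
  · rintro v ⟨p, hp, h⟩ w ⟨q, hq, h'⟩ hd
    exact ⟨_, hM.tensor_mem p hp q hq, h.tensor h' (by simpa using hd)⟩
  · intro x y w hw
    obtain ⟨p, hp, h⟩ := (hM.exists_hasRows_iff w.reverse [x, y]).2 (by simpa using hw)
    obtain ⟨q, hq, h'⟩ := (hM.exists_hasRows_iff [0, 0] []).2 hpair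
    have e : p.lower = q.upper := by simp [h.lower_length, h'.upper_length]
    simpa using (hM.exists_hasRows_iff _ _).1 ⟨_, hM.comp_mem p hp q hq e, h.comp_cap h' e⟩

theorem gen_mul_self (n : ℕ) : gen n * gen n = 1 := by
  rw [gen, ← map_mul, ← ofAdd_add, show (1 + 1 : ZMod 2) = 0 from rfl, ofAdd_zero, map_one]

theorem gen_inv (n : ℕ) : (gen n)⁻¹ = gen n :=
  inv_eq_of_mul_eq_one_left (gen_mul_self n)

/-- The element of `Z_2^{*∞}` spelled by a word. -/
def evalWord (w : List ℕ) : FreeZ2 := (w.map gen).prod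

theorem evalWord_nil : evalWord [] = 1 := rfl

theorem evalWord_cons (a : ℕ) (w : List ℕ) : evalWord (a :: w) = gen a * evalWord w := by
  simp [evalWord]

theorem evalWord_append (v w : List ℕ) : evalWord (v ++ w) = evalWord v * evalWord w := by
  simp [evalWord]

theorem evalWord_reverse (w : List ℕ) : evalWord w.reverse = (evalWord w)⁻¹ := by
  induction w with
  | nil => simp [evalWord_nil]
  | cons a w ih =>
    rw [List.reverse_cons, evalWord_append, ih, evalWord_cons, evalWord_cons, evalWord_nil,
      mul_one, mul_inv_rev, gen_inv]

theorem exists_evalWord (g : FreeZ2) : ∃ w, evalWord w = g := by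
  induction g using Monoid.CoprodI.induction_on with
  | one => exact ⟨[], rfl⟩
  | of i m =>
    obtain rfl | rfl : m = 1 ∨ m = Multiplicative.ofAdd 1 := by
      revert m
      decide
    · exact ⟨[], (map_one _).symm⟩
    · exact ⟨[i], by rw [evalWord_cons, evalWord_nil, mul_one, gen]⟩
  | mul x y hx hy =>
    obtain ⟨v, rfl⟩ := hx
    obtain ⟨w, rfl⟩ := hy
    exact ⟨v ++ w, evalWord_append v w⟩

theorem identifyLetters_evalWord (f : ℕ → ℕ) (w : List ℕ) :
    identifyLetters f (evalWord w) = evalWord (w.map f) := by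
  induction w with
  | nil => exact map_one _
  | cons a w ih =>
    rw [List.map_cons, evalWord_cons, evalWord_cons, map_mul, ih]
    congr 1

theorem IsSSInvariant.evalWord_map_mem {H : Set FreeZ2} (hH : IsSSInvariant H) {w : List ℕ}
    (hw : evalWord w ∈ H) (f : ℕ → ℕ) : evalWord (w.map f) ∈ H := by
  obtain ⟨n, hn⟩ := w.toFinset.exists_nat_subset_range
  have hmem := hH (identifyLetters fun k => if k < n then f k else k)
    (Subsemigroup.subset_closure ⟨_, ⟨n, fun k hk => if_neg hk.not_gt⟩, rfl⟩) _ hw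
  rw [identifyLetters_evalWord] at hmem
  rwa [List.map_congr_left (g := f)] at hmem
  intro a ha
  exact if_pos (Finset.mem_range.1 (hn (List.mem_toFinset.2 ha)))

/-- The syntactic congruence of a language. -/
def syntacticCon (S : Set (List ℕ)) : Con (FreeMonoid ℕ) where
  r v w := ∀ a b : List ℕ, a ++ v.toList ++ b ∈ S ↔ a ++ w.toList ++ b ∈ S
  iseqv := ⟨fun _ _ _ => Iff.rfl, fun h a b => (h a b).symm,
    fun h h' a b => (h a b).trans (h' a b)⟩
  mul' := by
    intro v v' w w' hv hw a b
    have h₁ := hv a (w.toList ++ b)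
    have h₂ := hw (a ++ v'.toList) b
    simp only [FreeMonoid.toList_mul, List.append_assoc] at h₁ h₂ ⊢
    exact h₁.trans h₂

/-- The homomorphism from `ℤ/2` determined by an element squaring to one. -/
def zmodTwoLift {N : Type*} [Monoid N] (x : N) (hx : x * x = 1) :
    Multiplicative (ZMod 2) →* N where
  toFun m := if m = 1 then 1 else x
  map_one' := if_pos rfl
  map_mul' := by
    have h : ∀ m : Multiplicative (ZMod 2), m = 1 ∨ m = Multiplicative.ofAdd 1 := by decide
    have h₁ : Multiplicative.ofAdd (1 : ZMod 2) ≠ 1 := by decide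
    have h₂ : Multiplicative.ofAdd (1 : ZMod 2) * Multiplicative.ofAdd 1 = 1 := by decide
    intro a b
    rcases h a with rfl | rfl <;> rcases h b with rfl | rfl <;> simp [h₁, h₂, hx]

/-- Membership in a group-theoretical language depends only on the group element spelled. -/
theorem IsGroupTheoreticalLanguage.mem_iff_of_evalWord_eq {S : Set (List ℕ)}
    (hS : IsGroupTheoreticalLanguage S) {v w : List ℕ} (h : evalWord v = evalWord w) :
    v ∈ S ↔ w ∈ S := by
  have hsq : ∀ n : ℕ, ((FreeMonoid.of n : FreeMonoid ℕ) : (syntacticCon S).Quotient) *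
      (FreeMonoid.of n : FreeMonoid ℕ) = 1 := by
    intro n
    rw [← Con.coe_mul, ← Con.coe_one, Con.eq]
    intro a b
    simpa using hS.insert_mem_iff (v := a) (w := b) n
  let φ : FreeZ2 →* (syntacticCon S).Quotient :=
    Monoid.CoprodI.lift fun n => zmodTwoLift _ (hsq n)
  have hφ : ∀ w : List ℕ, φ (evalWord w) = (FreeMonoid.ofList w : FreeMonoid ℕ) := by
    intro w
    induction w with
    | nil => exact map_one φ
    | cons a w ih =>
      rw [evalWord_cons, map_mul, ih, FreeMonoid.ofList_cons, Con.coe_mul]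
      congr 1
  have hvw := congrArg φ h
  rw [hφ, hφ, Con.eq] at hvw
  simpa using hvw [] []

theorem wordOf_eq_evalWord (p : PartitionDiagram) (lab : Fin p.upper ⊕ Fin p.lower → ℕ) :
    wordOf p lab = evalWord ((List.ofFn fun j => lab (Sum.inr j)) ++
      (List.ofFn fun i => lab (Sum.inl i)).reverse) := by
  simp [wordOf, evalWord, List.map_ofFn, Function.comp_def]

theorem mem_catOf_iff {H : Set FreeZ2} {p : PartitionDiagram} :
    p ∈ catOf H ↔ ∃ u l, HasRows p u l ∧ evalWord (l ++ u.reverse) ∈ H := by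
  constructor
  · rintro ⟨lab, h, hH⟩
    exact ⟨_, _, ⟨lab, h, rfl, rfl⟩, wordOf_eq_evalWord p lab ▸ hH⟩
  · rintro ⟨u, l, ⟨lab, h, rfl, rfl⟩, hH⟩
    exact ⟨lab, h, wordOf_eq_evalWord p lab ▸ hH⟩

theorem mem_Fmap_iff {M : Set PartitionDiagram} (hM : IsPartitionCategory M) {g : FreeZ2} :
    g ∈ Fmap M ↔ ∃ w ∈ lowerWords M, evalWord w = g := by
  constructor
  · rintro ⟨p, hp, lab, h, rfl⟩
    exact ⟨_, (hM.mem_iff_of_hasRows ⟨lab, h, rfl, rfl⟩).1 hp, (wordOf_eq_evalWord p lab).symm⟩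
  · rintro ⟨w, ⟨p, hp, lab, h, hu, rfl⟩, rfl⟩
    refine ⟨p, hp, lab, h, ?_⟩
    rw [wordOf_eq_evalWord, hu, List.reverse_nil, List.append_nil]

theorem evalWord_mem_Fmap_iff {M : Set PartitionDiagram} (hM : IsGroupTheoreticalCategory M)
    {w : List ℕ} : evalWord w ∈ Fmap M ↔ w ∈ lowerWords M := by
  rw [mem_Fmap_iff hM.1]
  refine ⟨?_, fun h => ⟨w, h, rfl⟩⟩
  rintro ⟨v, hv, e⟩
  exact (hM.isGroupTheoreticalLanguage.mem_iff_of_evalWord_eq e).1 hv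

theorem catOf_Fmap {M : Set PartitionDiagram} (hM : IsGroupTheoreticalCategory M) :
    catOf (Fmap M) = M := by
  ext p
  rw [mem_catOf_iff]
  constructor
  · rintro ⟨u, l, h, hp⟩
    exact (hM.1.mem_iff_of_hasRows h).2 ((evalWord_mem_Fmap_iff hM).1 hp)
  · intro hp
    obtain ⟨u, l, h⟩ := p.exists_hasRows
    exact ⟨u, l, h, (evalWord_mem_Fmap_iff hM).2 ((hM.1.mem_iff_of_hasRows h).1 hp)⟩

/-- The subgroup `F(M)` of `Z_2^{*∞}`. -/
def FmapSubgroup {M : Set PartitionDiagram} (hM : IsGroupTheoreticalCategory M) :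
    Subgroup FreeZ2 where
  carrier := Fmap M
  one_mem' := (mem_Fmap_iff hM.1).2
    ⟨[0, 0], hM.isGroupTheoreticalLanguage.pair_mem, by
      simp [evalWord_cons, evalWord_nil, gen_mul_self]⟩
  mul_mem' := by
    intro x y hx hy
    obtain ⟨v, rfl⟩ := exists_evalWord x
    obtain ⟨w, rfl⟩ := exists_evalWord y
    rw [← evalWord_append]
    rw [evalWord_mem_Fmap_iff hM] at hx hy ⊢
    exact hM.isGroupTheoreticalLanguage.append_mem' hx hy
  inv_mem' := by
    intro x hx
    obtain ⟨v, rfl⟩ := exists_evalWord x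
    rw [← evalWord_reverse]
    rw [evalWord_mem_Fmap_iff hM] at hx ⊢
    exact hM.isGroupTheoreticalLanguage.reverse_mem _ hx

theorem FmapSubgroup_normal {M : Set PartitionDiagram} (hM : IsGroupTheoreticalCategory M) :
    (FmapSubgroup hM).Normal := by
  refine ⟨fun x hx y => ?_⟩
  change _ ∈ Fmap M at hx ⊢
  obtain ⟨w, rfl⟩ := exists_evalWord x
  obtain ⟨v, rfl⟩ := exists_evalWord y
  rw [← evalWord_reverse, ← evalWord_append, ← evalWord_append]
  rw [evalWord_mem_Fmap_iff hM] at hx ⊢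
  exact hM.isGroupTheoreticalLanguage.conj_mem hx v

theorem isSSInvariant_Fmap {M : Set PartitionDiagram} (hM : IsGroupTheoreticalCategory M) :
    IsSSInvariant (Fmap M) := by
  intro φ hφ
  induction hφ using Subsemigroup.closure_induction with
  | mem φ hφ =>
    obtain ⟨f, -, rfl⟩ := hφ
    intro g hg
    obtain ⟨w, rfl⟩ := exists_evalWord g
    rw [identifyLetters_evalWord]
    rw [evalWord_mem_Fmap_iff hM] at hg ⊢
    exact hM.isGroupTheoreticalLanguage.map_mem hg f
  | mul φ ψ _ _ hφ hψ => exact fun g hg => hφ _ (hψ g hg)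

section CatOf

variable {H : Subgroup FreeZ2} (hinv : IsSSInvariant (H : Set FreeZ2))
include hinv

/-- For `p ∈ C_H`, every labelling constant on the blocks of `p` spells an element of `H`. -/
theorem evalWord_mem_of_mem_catOf {p : PartitionDiagram} (hp : p ∈ catOf (H : Set FreeZ2))
    (lab : Fin p.upper ⊕ Fin p.lower → ℕ) (hlab : ∀ x y, p.rel.r x y → lab x = lab y) :
    evalWord ((List.ofFn fun j => lab (Sum.inr j)) ++
      (List.ofFn fun i => lab (Sum.inl i)).reverse) ∈ H := by
  obtain ⟨u, l, h, hH⟩ := mem_catOf_iff.1 hp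
  obtain ⟨f, e₁, e₂⟩ := h.exists_map lab hlab
  rw [e₁, e₂, ← List.map_reverse, ← List.map_append]
  exact hinv.evalWord_map_mem hH f

theorem mem_catOf_iff_of_hasRows {p : PartitionDiagram} {u l : List ℕ} (h : HasRows p u l) :
    p ∈ catOf (H : Set FreeZ2) ↔ evalWord (l ++ u.reverse) ∈ H := by
  refine ⟨fun hp => ?_, fun hH => mem_catOf_iff.2 ⟨u, l, h, hH⟩⟩
  obtain ⟨lab, hlab, rfl, rfl⟩ := h
  exact evalWord_mem_of_mem_catOf hinv hp lab fun x y => (hlab x y).2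

theorem Fmap_catOf : Fmap (catOf (H : Set FreeZ2)) = H := by
  ext g
  constructor
  · rintro ⟨p, hp, lab, h, rfl⟩
    rw [wordOf_eq_evalWord]
    exact evalWord_mem_of_mem_catOf hinv hp lab fun x y => (h x y).2
  · intro hg
    obtain ⟨w, rfl⟩ := exists_evalWord g
    obtain ⟨p, hp⟩ := exists_diagram [] w
    have hpH := (mem_catOf_iff_of_hasRows hinv hp).2 (by simpa using hg)
    obtain ⟨lab, h, hu, rfl⟩ := hp
    refine ⟨p, hpH, lab, h, ?_⟩
    rw [wordOf_eq_evalWord, hu, List.reverse_nil, List.append_nil]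

theorem tensor_mem_catOf (hnor : H.Normal) {p q : PartitionDiagram}
    (hp : p ∈ catOf (H : Set FreeZ2)) (hq : q ∈ catOf (H : Set FreeZ2)) :
    tensor p q ∈ catOf (H : Set FreeZ2) := by
  obtain ⟨u, l, h⟩ := p.exists_hasRows
  obtain ⟨u', l', h'⟩ := q.exists_hasRows
  replace h := h.map (fun n => 2 * n) (fun a _ b _ e => by simpa using e)
  replace h' := h'.map (fun n => 2 * n + 1) (fun a _ b _ e => by simpa using e)
  rw [mem_catOf_iff_of_hasRows hinv h] at hp
  rw [mem_catOf_iff_of_hasRows hinv h'] at hq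
  rw [mem_catOf_iff_of_hasRows hinv (h.tensor h' (by
    intro a ha hb
    simp only [← List.map_append, List.mem_map] at ha hb
    omega))]
  simp only [List.reverse_append, evalWord_append] at hp hq ⊢
  simpa [mul_assoc] using H.mul_mem (hnor.conj_mem _ hq (evalWord (l.map fun n => 2 * n))) hp

theorem comp_mem_catOf {p q : PartitionDiagram}
    (hp : p ∈ catOf (H : Set FreeZ2)) (hq : q ∈ catOf (H : Set FreeZ2))
    (h : p.lower = q.upper) : comp p q h ∈ catOf (H : Set FreeZ2) := by
  obtain ⟨f, hf⟩ :=
    Countable.exists_injective_nat (Quotient (Relation.EqvGen.setoid (compRel p q h)))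
  let c := fun x => f (Quotient.mk (Relation.EqvGen.setoid (compRel p q h)) x)
  have hc : ∀ x y, c x = c y ↔ Relation.EqvGen.setoid (compRel p q h) x y := fun x y => by
    rw [hf.eq_iff, Quotient.eq]
  have h₁ := evalWord_mem_of_mem_catOf hinv hp (fun x => c (iotaP p q x)) fun x y hxy =>
    (hc _ _).2 (.rel _ _ (Or.inl ⟨x, y, hxy, rfl, rfl⟩))
  have h₂ := evalWord_mem_of_mem_catOf hinv hq (fun x => c (iotaQ p q h x)) fun x y hxy =>
    (hc _ _).2 (.rel _ _ (Or.inr ⟨x, y, hxy, rfl, rfl⟩))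
  refine mem_catOf_iff.2 ⟨_, _, ⟨fun x => c (Sum.map id Sum.inr x), fun x y => hc _ _, rfl, rfl⟩, ?_⟩
  have hmid : (List.ofFn fun i : Fin q.upper => c (iotaQ p q h (Sum.inl i))) =
      List.ofFn fun j : Fin p.lower => c (iotaP p q (Sum.inr j)) :=
    (List.ofFn_congr h fun j : Fin p.lower => c (iotaP p q (Sum.inr j))).symm
  rw [hmid] at h₂
  rw [evalWord_append, evalWord_reverse] at h₁ h₂
  have h₃ := H.mul_mem h₂ h₁
  rw [mul_assoc, inv_mul_cancel_left] at h₃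
  rw [SetLike.mem_coe, evalWord_append, evalWord_reverse]
  exact h₃

theorem isGroupTheoreticalCategory_catOf (hnor : H.Normal) :
    IsGroupTheoreticalCategory (catOf (H : Set FreeZ2)) := by
  refine ⟨⟨?_, ?_, fun p hp q hq => tensor_mem_catOf hinv hnor hp hq,
    fun p hp q hq h => comp_mem_catOf hinv hp hq h, ?_, ?_, ?_, ?_, ?_⟩, ?_⟩
  · refine mem_catOf_iff.2 ⟨_, _, hasRows_ofLabels _, ?_⟩
    simp [List.ofFn_succ, evalWord_cons, evalWord_nil, gen_mul_self, H.one_mem]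
  · refine mem_catOf_iff.2 ⟨_, _, hasRows_ofLabels _, ?_⟩
    simp [List.ofFn_succ, evalWord_cons, evalWord_nil, gen_mul_self, H.one_mem]
  · intro p hp
    obtain ⟨u, l, h⟩ := p.exists_hasRows
    rw [mem_catOf_iff_of_hasRows hinv h] at hp
    rw [mem_catOf_iff_of_hasRows hinv h.invol]
    simpa [evalWord_append, evalWord_reverse] using H.inv_mem hp
  · intro p hp h₀
    obtain ⟨u, l, h⟩ := p.exists_hasRows
    rw [mem_catOf_iff_of_hasRows hinv h] at hp
    obtain ⟨a, u, rfl⟩ := List.exists_cons_of_length_pos (h.upper_length ▸ h₀)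
    rw [mem_catOf_iff_of_hasRows hinv (h.rotLU h₀ rfl)]
    simpa [evalWord_append, evalWord_cons, evalWord_nil, mul_assoc] using
      hnor.mem_comm (a := evalWord l * evalWord u.reverse) (b := gen a)
        (by simpa [evalWord_append, evalWord_cons, evalWord_nil, mul_assoc] using hp)
  · intro p hp h₀
    obtain ⟨u, l, h⟩ := p.exists_hasRows
    rw [mem_catOf_iff_of_hasRows hinv h] at hp
    obtain ⟨a, l, rfl⟩ := List.exists_cons_of_length_pos (h.lower_length ▸ h₀)
    rw [mem_catOf_iff_of_hasRows hinv (h.rotLD h₀ rfl)]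
    simpa [evalWord_append, evalWord_cons, evalWord_nil, mul_assoc] using
      hnor.mem_comm (a := gen a) (b := evalWord l * evalWord u.reverse)
        (by simpa [evalWord_append, evalWord_cons, evalWord_nil, mul_assoc] using hp)
  · intro p hp h₀
    obtain ⟨u, l, h⟩ := p.exists_hasRows
    rw [mem_catOf_iff_of_hasRows hinv h] at hp
    obtain rfl | ⟨u, a, rfl⟩ := u.eq_nil_or_concat'
    · simp [h.upper_length] at h₀
    rw [mem_catOf_iff_of_hasRows hinv (h.rotRU h₀ rfl)]
    simpa using hp
  · intro p hp h₀
    obtain ⟨u, l, h⟩ := p.exists_hasRows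
    rw [mem_catOf_iff_of_hasRows hinv h] at hp
    obtain rfl | ⟨l, a, rfl⟩ := l.eq_nil_or_concat'
    · simp [h.lower_length] at h₀
    rw [mem_catOf_iff_of_hasRows hinv (h.rotRD h₀ rfl)]
    simpa using hp
  · refine mem_catOf_iff.2 ⟨_, _, hasRows_ofLabels _, ?_⟩
    have hcancel : ∀ (n : ℕ) (g : FreeZ2), gen n * (gen n * g) = g := fun n g => by
      rw [← mul_assoc, gen_mul_self, one_mul]
    simp [List.ofFn_succ, evalWord_cons, evalWord_nil, gen_mul_self, hcancel, H.one_mem]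

end CatOf

/-- The map `C ↦ F(C)` is a bijection from group-theoretical categories of
partitions onto `sS_∞`-invariant normal subgroups of `Z_2^{*∞}`, with inverse `H ↦ C_H`, and
it preserves and reflects inclusions; hence it is an isomorphism of lattices. -/
theorem Fmap_bijective_latticeIso :
    (∀ M : Set PartitionDiagram, IsGroupTheoreticalCategory M →
      (∃ H : Subgroup FreeZ2, H.Normal ∧ (H : Set FreeZ2) = Fmap M) ∧
        IsSSInvariant (Fmap M)) ∧
    (∀ H : Subgroup FreeZ2, H.Normal → IsSSInvariant (H : Set FreeZ2) →
      IsGroupTheoreticalCategory (catOf (H : Set FreeZ2)) ∧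
        Fmap (catOf (H : Set FreeZ2)) = (H : Set FreeZ2)) ∧
    (∀ M : Set PartitionDiagram, IsGroupTheoreticalCategory M → catOf (Fmap M) = M) ∧
    (∀ M N : Set PartitionDiagram, IsGroupTheoreticalCategory M →
      IsGroupTheoreticalCategory N → (M ⊆ N ↔ Fmap M ⊆ Fmap N)) := by
  refine ⟨fun M hM => ⟨⟨FmapSubgroup hM, FmapSubgroup_normal hM, rfl⟩, isSSInvariant_Fmap hM⟩,
    fun H hnor hinv => ⟨isGroupTheoreticalCategory_catOf hinv hnor, Fmap_catOf hinv⟩,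
    fun M hM => catOf_Fmap hM, fun M N hM hN => ⟨?_, fun h => ?_⟩⟩
  · rintro h g ⟨p, hp, hg⟩
    exact ⟨p, h hp, hg⟩
  · rw [← catOf_Fmap hM, ← catOf_Fmap hN]
    rintro p ⟨lab, hlab, hp⟩
    exact ⟨lab, hlab, h hp⟩
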